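/- arXiv:1412.3912 — 2 statements merged into one kernel-verified Lean document; each statement's English description precedes it below -/
import Mathlib

section
/- Let p > 5 be a prime, q = p^a, and let V be a finite-dimensional vector space over F_q. Let R ≤ GL(V) be a subgroup isomorphic to SL_2(5) acting nontrivially and absolutely irreducibly on V (i.e. V is an irreducible F_qR-module whose F_qR-endomorphism algebra consists only of the scalars F_q). If R is semiregular on V∖{0} (every nonzero vector has trivial stabilizer in R), then dim V = 2. -/
namespace SL25Aux

/-- The group `SL₂(5)`. -/
abbrev G5 : Type := Matrix.SpecialLinearGroup (Fin 2) (ZMod 5)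

/-- The negative of an upper triangular transvection. -/
def gx : G5 := ⟨!![4, 4; 0, 4], by decide⟩
/-- The negative of a lower triangular transvection. -/
def gy : G5 := ⟨!![4, 0; 2, 4], by decide⟩
/-- An element of order six. -/
def gg : G5 := ⟨!![4, 1; 2, 2], by decide⟩
/-- A second element of order six. -/
def gh : G5 := ⟨!![3, 4; 2, 3], by decide⟩

lemma gx_eq : gx = gg * gh := by decide
lemma gy_eq : gg * gy = gh := by decide
lemma gg_pow : gg ^ 6 = 1 := by decide
lemma gh_pow : gh ^ 6 = 1 := by decide
lemma gg_ne : gg ≠ 1 ∧ gg ^ 2 ≠ 1 ∧ gg ^ 3 ≠ 1 := by decide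
lemma gh_ne : gh ≠ 1 ∧ gh ^ 2 ≠ 1 ∧ gh ^ 3 ≠ 1 := by decide
lemma gxy_ne : gx * gy ≠ gy * gx := by decide

/-- The elements `gx` and `gy` generate the group. -/
lemma closure_eq_top : Subgroup.closure ({gx, gy} : Set G5) = ⊤ := by
  have : Fact (Nat.Prime 5) := ⟨by norm_num⟩
  have hx : gx ∈ Subgroup.closure ({gx, gy} : Set G5) := Subgroup.subset_closure (by simp)
  have hy : gy ∈ Subgroup.closure ({gx, gy} : Set G5) := Subgroup.subset_closure (by simp)
  refine le_antisymm le_top fun A _ => Matrix.SL2.transvection_induction _ ?_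
    (fun _ _ => mul_mem) A
  have hpow : ∀ c : ZMod 5, Matrix.SpecialLinearGroup.transvection
      (zero_ne_one : (0 : Fin 2) ≠ 1) c = gx ^ (6 * c.val) := by decide
  have hpow' : ∀ c : ZMod 5, Matrix.SpecialLinearGroup.transvection
      (one_ne_zero : (1 : Fin 2) ≠ 0) c = gy ^ (6 * (2 * c.val)) := by decide
  intro i j h c
  fin_cases i
  · obtain rfl : j = 1 := by fin_cases j <;> tauto
    exact (hpow c) ▸ pow_mem hx _
  · obtain rfl : j = 0 := by fin_cases j <;> tauto
    exact (hpow' c) ▸ pow_mem hy _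

section

variable {K V : Type} [Field K] [AddCommGroup V] [Module K V]

/-- An element of order six acts with `g + g⁻¹ = 1`. -/
lemma order_six (ρ : G5 →* Module.End K V)
    (hfix : ∀ g : G5, g ≠ 1 → ∀ v : V, ρ g v = v → v = 0)
    (g : G5) (h6 : g ^ 6 = 1) (hg : g ≠ 1 ∧ g ^ 2 ≠ 1 ∧ g ^ 3 ≠ 1) :
    ρ g + ρ g⁻¹ = 1 := by
  obtain ⟨h1, h2, h3⟩ := hg
  have inj : ∀ k : ℕ, g ^ k ≠ 1 → ∀ A : Module.End K V, (ρ g ^ k - 1) * A = 0 → A = 0 := by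
    intro k hk A hA
    ext v
    refine hfix _ hk _ ?_
    have := congrArg (fun f : Module.End K V => f v) hA
    simp only [Module.End.mul_apply, LinearMap.sub_apply, Module.End.one_apply,
      LinearMap.zero_apply, sub_eq_zero] at this
    rw [map_pow]; exact this
  have e6 : ρ g ^ 6 = 1 := by rw [← map_pow, h6, map_one]
  have e3 : ρ g ^ 3 + 1 = 0 := inj 3 h3 _ (by
    have : (ρ g ^ 3 - 1) * (ρ g ^ 3 + 1) = ρ g ^ 6 - 1 := by noncomm_ring
    rw [this, e6, sub_self])
  have e2 : ρ g ^ 2 - ρ g + 1 = 0 := inj 2 h2 _ (by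
    have : (ρ g ^ 2 - 1) * (ρ g ^ 2 - ρ g + 1) = (ρ g - 1) * (ρ g ^ 3 + 1) := by noncomm_ring
    rw [this, e3, mul_zero])
  have hi : ρ g⁻¹ * ρ g = 1 := by rw [← map_mul, inv_mul_cancel, map_one]
  have h4 : ρ g⁻¹ * (ρ g ^ 2 - ρ g + 1) = ρ g + ρ g⁻¹ - 1 := by
    have : ρ g⁻¹ * (ρ g ^ 2 - ρ g + 1) = (ρ g⁻¹ * ρ g) * ρ g - ρ g⁻¹ * ρ g + ρ g⁻¹ := by
      noncomm_ring
    rw [this, hi]; noncomm_ring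
  rw [e2, mul_zero] at h4
  exact (sub_eq_zero.mp h4.symm)

/-- Density: an irreducible family with only scalar endomorphisms spans `End V`. -/
lemma adjoin_eq_top [Finite V] [Nontrivial V] (ρ : G5 →* Module.End K V)
    (hirr : ∀ W : Submodule K V, (∀ g, ∀ v ∈ W, ρ g v ∈ W) → W = ⊥ ∨ W = ⊤)
    (habs : ∀ f : V →ₗ[K] V, (∀ g, ∀ v : V, f (ρ g v) = ρ g (f v)) →
      ∃ c : K, f = c • (LinearMap.id : V →ₗ[K] V)) :
    Algebra.adjoin K (Set.range ρ) = ⊤ := by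
  let S : Subalgebra K (Module.End K V) := Algebra.adjoin K (Set.range ρ)
  have hmem : ∀ g, ρ g ∈ S := fun g => Algebra.subset_adjoin ⟨g, rfl⟩
  have : IsSimpleModule S V := by
    have : IsSimpleOrder (Submodule S V) :=
      { eq_bot_or_eq_top := fun W => by
          have := hirr (W.restrictScalars K) (fun g v hv => W.smul_mem (⟨ρ g, hmem g⟩ : S) hv)
          simpa using this }
    exact {}
  refine eq_top_iff.mpr fun f _ => ?_
  have hlin : ∀ (φ : Module.End S V) (v : V), f (φ v) = φ (f v) := by
    intro φ v
    obtain ⟨c, hc⟩ := habs (φ.restrictScalars K)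
      (fun g v => φ.map_smul (⟨ρ g, hmem g⟩ : S) v)
    have hc' : ∀ v, φ v = c • v := fun v => congrArg (fun f : V →ₗ[K] V => f v) hc
    rw [hc', hc', map_smul]
  let F : Module.End (Module.End S V) V :=
    { toFun := f, map_add' := map_add f, map_smul' := hlin }
  letI := Fintype.ofFinite V
  obtain ⟨r, hr⟩ := jacobson_density (R := S) F Finset.univ
  have : f = r.1 := LinearMap.ext fun v => hr v (Finset.mem_univ v)
  rw [this]
  exact r.2

/-- The main statement for a representation of `SL₂(5)`. -/
lemma main [Finite V] (ρ : G5 →* Module.End K V)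
    (hirr : ∀ W : Submodule K V, (∀ g, ∀ v ∈ W, ρ g v ∈ W) → W = ⊥ ∨ W = ⊤)
    (habs : ∀ f : V →ₗ[K] V, (∀ g, ∀ v : V, f (ρ g v) = ρ g (f v)) →
      ∃ c : K, f = c • (LinearMap.id : V →ₗ[K] V))
    (hinj : Function.Injective ρ)
    (hfix : ∀ g : G5, g ≠ 1 → ∀ v : V, ρ g v = v → v = 0) :
    Module.finrank K V = 2 := by
  have hnc : ρ gx * ρ gy ≠ ρ gy * ρ gx := by
    rw [← map_mul, ← map_mul]; exact fun h => gxy_ne (hinj h)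
  have : Nontrivial V := by
    by_contra hV
    rw [not_nontrivial_iff_subsingleton] at hV
    exact hnc (LinearMap.ext fun v => Subsingleton.elim _ _)
  have : Module.Finite K V := inferInstance
  have hG := order_six ρ hfix gg gg_pow gg_ne
  have hH := order_six ρ hfix gh gh_pow gh_ne
  have hGG : ρ gg * ρ gg⁻¹ = 1 := by rw [← map_mul, mul_inv_cancel, map_one]
  have inv1 : ∀ g, ρ g * ρ g⁻¹ = 1 := fun g => by rw [← map_mul, mul_inv_cancel, map_one]
  have inv2 : ∀ g, ρ g⁻¹ * ρ g = 1 := fun g => by rw [← map_mul, inv_mul_cancel, map_one]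
  -- the trace relation
  have hT : (ρ gx + ρ gx⁻¹) + (ρ gy + ρ gy⁻¹) = 1 := by
    have ey : gy = gg⁻¹ * gh := by rw [← gy_eq]; group
    rw [ey, gx_eq]
    simp only [mul_inv_rev, inv_inv, map_mul]
    calc _ = (ρ gg + ρ gg⁻¹) * ρ gh + ρ gh⁻¹ * (ρ gg + ρ gg⁻¹) := by noncomm_ring
      _ = 1 := by rw [hG, one_mul, mul_one, hH]
  have hT' : ρ gx + ρ gx⁻¹ = 1 - (ρ gy + ρ gy⁻¹) := eq_sub_of_add_eq hT
  -- it is central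
  have hcent : ∀ g, Commute (ρ gx + ρ gx⁻¹) (ρ g) := by
    intro g
    have hg : g ∈ Subgroup.closure ({gx, gy} : Set G5) := by rw [closure_eq_top]; trivial
    induction hg using Subgroup.closure_induction with
    | mem z hz =>
      rcases hz with rfl | hz
      · refine Commute.add_left (Commute.refl _) ?_
        rw [Commute, SemiconjBy, inv1, inv2]
      · rw [Set.mem_singleton_iff] at hz
        subst hz
        rw [hT']
        refine Commute.sub_left (Commute.one_left _) (Commute.add_left (Commute.refl _) ?_)
        rw [Commute, SemiconjBy, inv1, inv2]
    | one => rw [map_one]; exact Commute.one_right _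
    | mul a b _ _ ha hb => rw [map_mul]; exact ha.mul_right hb
    | inv a _ ha =>
      have h1 : (ρ gx + ρ gx⁻¹) = ρ a * (ρ gx + ρ gx⁻¹) * ρ a⁻¹ := by
        rw [← ha.eq, mul_assoc, inv1, mul_one]
      rw [Commute, SemiconjBy]
      calc _ = ρ a⁻¹ * ρ a * (ρ gx + ρ gx⁻¹) * ρ a⁻¹ := by rw [inv2, one_mul]
        _ = ρ a⁻¹ * (ρ a * (ρ gx + ρ gx⁻¹) * ρ a⁻¹) := by simp only [mul_assoc]
        _ = _ := by rw [← h1]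
  obtain ⟨c, hc⟩ := habs (ρ gx + ρ gx⁻¹)
    (fun g v => congrArg (fun f : V →ₗ[K] V => f v) (hcent g).eq)
  have hc1 : ρ gx + ρ gx⁻¹ = c • (1 : Module.End K V) := hc
  obtain ⟨d, hd⟩ : ∃ d : K, ρ gy + ρ gy⁻¹ = d • (1 : Module.End K V) := by
    refine ⟨1 - c, ?_⟩
    rw [sub_smul, one_smul, ← hc1, ← hT]; abel
  -- the product relation
  have hxy : ρ gx * ρ gy⁻¹ + ρ gy * ρ gx⁻¹ = -1 := by
    have e1 : gx * gy⁻¹ = gg * gg := by rw [gx_eq, ← gy_eq]; group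
    have e2 : gy * gx⁻¹ = gg⁻¹ * gg⁻¹ := by rw [gx_eq, ← gy_eq]; group
    rw [← map_mul, ← map_mul, e1, e2, map_mul, map_mul]
    calc _ = (ρ gg + ρ gg⁻¹) * (ρ gg + ρ gg⁻¹) - ρ gg * ρ gg⁻¹ - ρ gg⁻¹ * ρ gg := by noncomm_ring
      _ = -1 := by rw [hG, inv1, inv2]; noncomm_ring
  have hXi : ρ gx⁻¹ = c • (1 : Module.End K V) - ρ gx := eq_sub_of_add_eq' hc1
  have hYi : ρ gy⁻¹ = d • (1 : Module.End K V) - ρ gy := eq_sub_of_add_eq' hd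
  have hXX : ρ gx * ρ gx = c • ρ gx - 1 := by
    have := inv1 gx
    rw [hXi, mul_sub, mul_smul_comm, mul_one] at this
    rw [← this]; abel
  have hYY : ρ gy * ρ gy = d • ρ gy - 1 := by
    have := inv1 gy
    rw [hYi, mul_sub, mul_smul_comm, mul_one] at this
    rw [← this]; abel
  have hYX : ρ gy * ρ gx = d • ρ gx + c • ρ gy + 1 - ρ gx * ρ gy := by
    rw [hXi, hYi, mul_sub, mul_sub, mul_smul_comm, mul_smul_comm, mul_one, mul_one] at hxy
    rw [← neg_neg (1 : Module.End K V), ← hxy]; abel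
  -- the spanning set
  let L : Submodule K (Module.End K V) :=
    Submodule.span K (Set.range ![1, ρ gx, ρ gy, ρ gx * ρ gy])
  have m0 : (1 : Module.End K V) ∈ L := Submodule.subset_span ⟨0, rfl⟩
  have m1 : ρ gx ∈ L := Submodule.subset_span ⟨1, rfl⟩
  have m2 : ρ gy ∈ L := Submodule.subset_span ⟨2, rfl⟩
  have m3 : ρ gx * ρ gy ∈ L := Submodule.subset_span ⟨3, rfl⟩
  have hspan : ∀ A : Module.End K V, A ∈ L → A * ρ gy ∈ L → A * ρ gx ∈ L →
      A * (ρ gx * ρ gy) ∈ L → ∀ B ∈ L, A * B ∈ L := by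
    intro A h0 h2 h1 h3 B hB
    induction hB using Submodule.span_induction with
    | mem z hz =>
      obtain ⟨i, rfl⟩ := hz
      fin_cases i
      · simpa using h0
      · exact h1
      · exact h2
      · exact h3
    | zero => rw [mul_zero]; exact L.zero_mem
    | add a b _ _ ha hb => rw [mul_add]; exact L.add_mem ha hb
    | smul k a _ ha => rw [mul_smul_comm]; exact L.smul_mem _ ha
  have hX : ∀ B ∈ L, ρ gx * B ∈ L := by
    refine hspan _ m1 m3 ?_ ?_
    · rw [hXX]; exact L.sub_mem (L.smul_mem _ m1) m0
    · rw [← mul_assoc, hXX, sub_mul, smul_mul_assoc, one_mul]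
      exact L.sub_mem (L.smul_mem _ m3) m2
  have hY : ∀ B ∈ L, ρ gy * B ∈ L := by
    have hyx : ρ gy * ρ gx ∈ L := by
      rw [hYX]
      exact L.sub_mem (L.add_mem (L.add_mem (L.smul_mem _ m1) (L.smul_mem _ m2)) m0) m3
    have hyy : ρ gy * ρ gy ∈ L := by
      rw [hYY]; exact L.sub_mem (L.smul_mem _ m2) m0
    refine hspan _ m2 hyy hyx ?_
    rw [← mul_assoc, hYX, sub_mul, add_mul, add_mul, smul_mul_assoc, smul_mul_assoc, one_mul,
      mul_assoc]
    exact L.sub_mem (L.add_mem (L.add_mem (L.smul_mem _ m3) (L.smul_mem _ hyy)) m2) (hX _ hyy)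
  have hall : ∀ g, ∀ B ∈ L, ρ g * B ∈ L := by
    intro g
    have hg : g ∈ Subgroup.closure ({gx, gy} : Set G5) := by rw [closure_eq_top]; trivial
    induction hg using Subgroup.closure_induction'' with
    | mem z hz =>
      rcases hz with rfl | hz
      · exact hX
      · rw [Set.mem_singleton_iff] at hz
        subst hz
        exact hY
    | inv_mem z hz =>
      rcases hz with rfl | hz
      · intro B hB
        rw [hXi, sub_mul, smul_mul_assoc, one_mul]
        exact L.sub_mem (L.smul_mem _ hB) (hX B hB)
      · rw [Set.mem_singleton_iff] at hz
        subst hz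
        intro B hB
        rw [hYi, sub_mul, smul_mul_assoc, one_mul]
        exact L.sub_mem (L.smul_mem _ hB) (hY B hB)
    | one => intro B hB; rw [map_one, one_mul]; exact hB
    | mul a b _ _ ha hb => intro B hB; rw [map_mul, mul_assoc]; exact ha _ (hb _ hB)
  have hS : ∀ A ∈ Algebra.adjoin K (Set.range ρ), ∀ B ∈ L, A * B ∈ L := by
    intro A hA
    induction hA using Algebra.adjoin_induction with
    | mem z hz => obtain ⟨g, rfl⟩ := hz; exact hall g
    | algebraMap r =>
      intro B hB
      rw [Algebra.algebraMap_eq_smul_one, smul_mul_assoc, one_mul]; exact L.smul_mem _ hB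
    | add a b _ _ ha hb => intro B hB; rw [add_mul]; exact L.add_mem (ha B hB) (hb B hB)
    | mul a b _ _ ha hb => intro B hB; rw [mul_assoc]; exact ha _ (hb _ hB)
  have hL : L = ⊤ := by
    refine eq_top_iff.mpr fun A _ => ?_
    have := hS A (by rw [adjoin_eq_top ρ hirr habs]; trivial) 1 m0
    rwa [mul_one] at this
  have hle : Module.finrank K (Module.End K V) ≤ 4 := by
    have h := finrank_range_le_card (R := K) ![1, ρ gx, ρ gy, ρ gx * ρ gy]
    rw [Set.finrank] at h
    change Module.finrank K L ≤ _ at h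
    rw [hL, finrank_top] at h
    simpa using h
  rw [Module.finrank_linearMap] at hle
  have hpos : 0 < Module.finrank K V := Module.finrank_pos
  have hne : Module.finrank K V ≠ 1 := by
    intro h1
    obtain ⟨v, hv, hs⟩ := finrank_eq_one_iff'.mp h1
    obtain ⟨a, ha⟩ := hs (ρ gx v)
    obtain ⟨b, hb⟩ := hs (ρ gy v)
    apply hnc
    ext w
    obtain ⟨k, rfl⟩ := hs w
    simp only [Module.End.mul_apply, map_smul, ← ha, ← hb]
    rw [smul_comm a b]
  have : Module.finrank K V ≤ 2 := by nlinarith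
  omega

end

end SL25Aux

/-- **Proposition 2.2(i) (Liebeck–Praeger–Saxl).** Let `p > 5` be a prime, `q = p^a`, and
`V` a nontrivial absolutely irreducible `𝔽_q SL₂(5)`-module. If `SL₂(5)` acts semiregularly
on the nonzero vectors of `V`, then `dim V = 2`. -/
theorem sl2_5_semiregular_dim_two
    (p a : ℕ) (hp : p.Prime) (hp5 : 5 < p) (ha : 1 ≤ a)
    (K : Type) [Field K] [Fintype K] (hK : Nat.card K = p ^ a)
    (V : Type) [AddCommGroup V] [Module K V] [Finite V]
    (R : Subgroup (V ≃ₗ[K] V))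
    (hR : Nonempty (R ≃* Matrix.SpecialLinearGroup (Fin 2) (ZMod 5)))
    -- `R` acts nontrivially,
    (hnontriv : R ≠ ⊥)
    -- irreducibly,
    (hirr : ∀ W : Submodule K V, (∀ g ∈ R, ∀ v ∈ W, g v ∈ W) → W = ⊥ ∨ W = ⊤)
    -- and absolutely irreducibly: every `R`-equivariant endomorphism is a scalar,
    (habs : ∀ f : V →ₗ[K] V, (∀ g ∈ R, ∀ v : V, f (g v) = g (f v)) →
      ∃ c : K, f = c • (LinearMap.id : V →ₗ[K] V))
    -- and `R` is semiregular on the nonzero vectors: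
    (hsemireg : ∀ g ∈ R, ∀ v : V, v ≠ 0 → g v = v → g = 1) :
    Module.finrank K V = 2 := by
  obtain ⟨e⟩ := hR
  let ρ : SL25Aux.G5 →* Module.End K V :=
    (LinearEquiv.automorphismGroup.toLinearMapMonoidHom.comp R.subtype).comp e.symm.toMonoidHom
  have hρ : ∀ g v, ρ g v = (e.symm g : V ≃ₗ[K] V) v := fun _ _ => rfl
  have hρ' : ∀ (g : V ≃ₗ[K] V) (hg : g ∈ R) v, ρ (e ⟨g, hg⟩) v = g v := by
    intro g hg v
    rw [hρ, e.symm_apply_apply]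
  refine SL25Aux.main ρ ?_ ?_ ?_ ?_
  · intro W hW
    refine hirr W fun g hg v hv => ?_
    rw [← hρ' g hg]; exact hW _ v hv
  · intro f hf
    refine habs f fun g hg v => ?_
    rw [← hρ' g hg, ← hρ' g hg]; exact hf _ v
  · intro g h hgh
    apply e.symm.injective
    apply Subtype.ext
    ext v
    rw [← hρ, ← hρ, hgh]
  · intro g hg v hv
    by_contra hv0
    apply hg
    have := hsemireg _ (e.symm g).2 v hv0 hv
    apply e.symm.injective
    rw [map_one]
    exact Subtype.ext this
end

section
/- For each of the following parameter sets there exists a subgroup G ≤ GL_2(F_p) containing a normal subgroup isomorphic to SL_2(5) which is ½-transitive but not semiregular on the nonzero vectors of F_p², with the stated orbit structure: p = 11, |G| = 600, one orbit of size 120; p = 19, |G| = 360, three orbits each of size 120; p = 19, |G| = 1080, one orbit of size 360; p = 29, |G| = 240, seven orbits each of size 120; p = 29, |G| = 1680, one orbit of size 840. -/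
/-- `HasHalfTransitiveExample p cardG orbSize numOrbits` says: there is a subgroup
`G ≤ GL₂(𝔽_p)` of order `cardG`, with a normal subgroup isomorphic to `SL₂(5)`, which is
`½`-transitive but not semiregular on the nonzero vectors of `𝔽_p²`, all of whose orbits on
nonzero vectors have size `orbSize`, and with exactly `numOrbits` such orbits. -/
def HasHalfTransitiveExample (p cardG orbSize numOrbits : ℕ) : Prop :=
  ∃ G : Subgroup ((Fin 2 → ZMod p) ≃ₗ[ZMod p] (Fin 2 → ZMod p)),
    Nat.card G = cardG ∧
    (∃ R : Subgroup G, R.Normal ∧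
      Nonempty (R ≃* Matrix.SpecialLinearGroup (Fin 2) (ZMod 5))) ∧
    (∀ v : Fin 2 → ZMod p, v ≠ 0 → Nat.card (MulAction.orbit G v) = orbSize) ∧
    Nat.card {s : Set (Fin 2 → ZMod p) //
      ∃ v : Fin 2 → ZMod p, v ≠ 0 ∧ s = MulAction.orbit G v} = numOrbits ∧
    ¬ ∀ g ∈ G, ∀ v : Fin 2 → ZMod p, v ≠ 0 → g v = v → g = 1


namespace HT

/-- A 2×2 matrix given by its entries, row by row. -/
structure Q (p : ℕ) where
  a : ZMod p
  b : ZMod p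
  c : ZMod p
  d : ZMod p

instance {p : ℕ} : DecidableEq (Q p) := fun x y =>
  decidable_of_iff (x.a = y.a ∧ x.b = y.b ∧ x.c = y.c ∧ x.d = y.d) (by
    cases x
    cases y
    simp)

/-- Matrix product. -/
def Q.mul {p : ℕ} (x y : Q p) : Q p :=
  ⟨x.a * y.a + x.b * y.c, x.a * y.b + x.b * y.d,
   x.c * y.a + x.d * y.c, x.c * y.b + x.d * y.d⟩

/-- Negation. -/
def Q.neg {p : ℕ} (x : Q p) : Q p := ⟨-x.a, -x.b, -x.c, -x.d⟩

/-- The entry of a five element table at `x`. -/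
def tab {α : Type} (t0 t1 t2 t3 t4 : α) (x : ZMod 5) : α :=
  match x.val with
  | 0 => t0
  | 1 => t1
  | 2 => t2
  | 3 => t3
  | _ => t4

/-- Image of an element of `SL₂(5)` with `c ≠ 0`,
which is `u(x) w u(c) w u(z)`, `x = (a+1)/c`, `z = (d+1)/c`. -/
def F0 {p : ℕ} (T : ZMod 5 → Q p) (W : Q p) (a c d : ZMod 5) : Q p :=
  (T ((a + 1) * (c * c * c))).mul (W.mul ((T c).mul (W.mul (T ((d + 1) * (c * c * c))))))

/-- Image of an element of `SL₂(5)`. -/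
def F {p : ℕ} (T : ZMod 5 → Q p) (W : Q p) (a b c d : ZMod 5) : Q p :=
  if c = 0 then W.neg.mul (F0 T W (-c) a b) else F0 T W a c d

/-- The finitely many identities making `F` a suitable representation. -/
structure Good (p : ℕ) (T : ZMod 5 → Q p) (W : Q p) : Prop where
  one : F T W 1 0 0 1 = ⟨1, 0, 0, 1⟩
  neg : F T W (-1) 0 0 (-1) = ⟨-1, 0, 0, -1⟩
  w : ∀ a b c d : ZMod 5, a * d - b * c = 1 → F T W (-c) (-d) a b = W.mul (F T W a b c d)
  wF : F T W 0 (-1) 1 0 = W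
  u : ∀ a b c d : ZMod 5, a * d - b * c = 1 → ∀ x : ZMod 5,
    F T W (a + x * c) (b + x * d) c d = (T x).mul (F T W a b c d)
  uF : ∀ x : ZMod 5, F T W 1 x 0 1 = T x
  fix : ∀ a b c d : ZMod 5, a * d - b * c = 1 →
    ((F T W a b c d).a - 1) * ((F T W a b c d).d - 1) - (F T W a b c d).b * (F T W a b c d).c = 0 →
    a = 1 ∧ b = 0 ∧ c = 0 ∧ d = 1
  scal : ∀ a b c d : ZMod 5, a * d - b * c = 1 →
    (F T W a b c d).b = 0 ∧ (F T W a b c d).c = 0 ∧ (F T W a b c d).a = (F T W a b c d).d →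
    a = d ∧ b = 0 ∧ c = 0 ∧ (d = 1 ∨ d = -1)

/-- `SL₂(5)` is transitive on lines. -/
def Trans (p : ℕ) (T : ZMod 5 → Q p) (W : Q p) : Prop :=
  (∀ x : ZMod p, ∃ a b c d : ZMod 5, a * d - b * c = 1 ∧ (F T W a b c d).a ≠ 0 ∧
    (F T W a b c d).c = x * (F T W a b c d).a) ∧
  ∃ a b c d : ZMod 5, a * d - b * c = 1 ∧ (F T W a b c d).a = 0

/-- every vector is an eigenvector with eigenvalue `l` of an element of `SL₂(5)` -/
def Eig (p : ℕ) (T : ZMod 5 → Q p) (W : Q p) (l : ZMod p) : Prop :=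
  (∀ x : ZMod p, ∃ a b c d : ZMod 5, a * d - b * c = 1 ∧
    (F T W a b c d).a + (F T W a b c d).b * x = l ∧
    (F T W a b c d).c + (F T W a b c d).d * x = l * x) ∧
  ∃ a b c d : ZMod 5, a * d - b * c = 1 ∧ (F T W a b c d).b = 0 ∧ (F T W a b c d).d = l

def T11 : ZMod 5 → Q 11 :=
  tab ⟨1, 0, 0, 1⟩ ⟨0, 10, 1, 3⟩ ⟨10, 8, 3, 8⟩ ⟨8, 3, 8, 10⟩ ⟨3, 1, 10, 0⟩
def W11 : Q 11 := ⟨3, 3, 4, 8⟩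
def T19 : ZMod 5 → Q 19 :=
  tab ⟨1, 0, 0, 1⟩ ⟨0, 18, 1, 4⟩ ⟨18, 15, 4, 15⟩ ⟨15, 4, 15, 18⟩ ⟨4, 1, 18, 0⟩
def W19 : Q 19 := ⟨0, 8, 7, 0⟩
def T29 : ZMod 5 → Q 29 :=
  tab ⟨1, 0, 0, 1⟩ ⟨0, 28, 1, 5⟩ ⟨28, 24, 5, 24⟩ ⟨24, 5, 24, 28⟩ ⟨5, 1, 28, 0⟩
def W29 : Q 29 := ⟨1, 9, 3, 28⟩

theorem good11 : Good 11 T11 W11 := by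
  constructor <;> decide +kernel
theorem good19 : Good 19 T19 W19 := by
  constructor <;> decide +kernel
theorem good29 : Good 29 T29 W29 := by
  constructor <;> decide +kernel
theorem trans11 : Trans 11 T11 W11 := by
  constructor <;> decide +kernel
theorem trans19 : Trans 19 T19 W19 := by
  constructor <;> decide +kernel
theorem trans29 : Trans 29 T29 W29 := by
  constructor <;> decide +kernel
theorem eig19 : Eig 19 T19 W19 7 := by
  constructor <;> decide +kernel
theorem eig29 : Eig 29 T29 W29 12 := by
  constructor <;> decide +kernel

open Matrix

set_option linter.unusedSimpArgs false

abbrev S5 := Matrix.SpecialLinearGroup (Fin 2) (ZMod 5)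
abbrev V (p : ℕ) := Fin 2 → ZMod p

def Q.mat {p : ℕ} (x : Q p) : Matrix (Fin 2) (Fin 2) (ZMod p) := !![x.a, x.b; x.c, x.d]

theorem Q.mat_mul {p : ℕ} (x y : Q p) : (x.mul y).mat = x.mat * y.mat := by
  simp [Q.mat, Q.mul]

def FF {p : ℕ} (T : ZMod 5 → Q p) (W : Q p) (g : S5) : Q p :=
  F T W (g 0 0) (g 0 1) (g 1 0) (g 1 1)

theorem det_eq (g : S5) : g 0 0 * g 1 1 - g 0 1 * g 1 0 = 1 := by
  have := g.det_coe
  rwa [Matrix.det_fin_two] at this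

def mk (a b c d : ZMod 5) (h : a * d - b * c = 1) : S5 :=
  ⟨!![a, b; c, d], by rw [Matrix.det_fin_two]; simpa using h⟩

def wS : S5 := mk 0 (-1) 1 0 (by decide)
def uS (x : ZMod 5) : S5 := mk 1 x 0 1 (by ring)

theorem mul_ent (g h : S5) (i j : Fin 2) : (g * h) i j = g i 0 * h 0 j + g i 1 * h 1 j := by
  rw [Matrix.SpecialLinearGroup.coe_mul, Matrix.mul_apply, Fin.sum_univ_two]

theorem w00 : wS 0 0 = 0 := rfl
theorem w01 : wS 0 1 = -1 := rfl
theorem w10 : wS 1 0 = 1 := rfl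
theorem w11 : wS 1 1 = 0 := rfl
theorem u00 (x : ZMod 5) : uS x 0 0 = 1 := rfl
theorem u01 (x : ZMod 5) : uS x 0 1 = x := rfl
theorem u10 (x : ZMod 5) : uS x 1 0 = 0 := rfl
theorem u11 (x : ZMod 5) : uS x 1 1 = 1 := rfl

theorem ext4 {g h : S5} (h1 : g 0 0 = h 0 0) (h2 : g 0 1 = h 0 1) (h3 : g 1 0 = h 1 0)
    (h4 : g 1 1 = h 1 1) : g = h := by
  ext i j
  fin_cases i <;> fin_cases j <;> assumption

section
variable {p : ℕ} {T : ZMod 5 → Q p} {W : Q p}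

theorem FF_mk (a b c d : ZMod 5) (h) : FF T W (mk a b c d h) = F T W a b c d := rfl

theorem FF_w (hG : Good p T W) (g : S5) : FF T W (wS * g) = W.mul (FF T W g) := by
  rw [FF, FF, ← hG.w _ _ _ _ (det_eq g)]
  simp [mul_ent, w00, w01, w10, w11, u00, u01, u10, u11]

theorem FF_u (hG : Good p T W) (x : ZMod 5) (g : S5) :
    FF T W (uS x * g) = (T x).mul (FF T W g) := by
  rw [FF, FF, ← hG.u _ _ _ _ (det_eq g)]
  simp [mul_ent, w00, w01, w10, w11, u00, u01, u10, u11]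

theorem S5_induction (M : Submonoid S5) (hw : wS ∈ M) (hu : ∀ x, uS x ∈ M) (g : S5) : g ∈ M := by
  have key : ∀ g : S5, g 1 0 ≠ 0 → g ∈ M := by
    intro g hg
    have hc : g 1 0 * (g 1 0 * g 1 0 * g 1 0) = 1 := by
      generalize g 1 0 = c at hg
      revert c; decide
    have : g = uS ((g 0 0 + 1) * (g 1 0 * g 1 0 * g 1 0)) * (wS * (uS (g 1 0) * (wS *
        uS ((g 1 1 + 1) * (g 1 0 * g 1 0 * g 1 0))))) := by
      have hd := det_eq g
      apply ext4 <;> simp only [mul_ent, w00, w01, w10, w11, u00, u01, u10, u11]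
      · linear_combination (-(g 0 0 + 1)) * hc
      · generalize g 0 0 = a at *
        generalize g 0 1 = b at *
        generalize g 1 0 = c at *
        generalize g 1 1 = d at *
        revert a b c d
        decide +kernel
      · ring
      · linear_combination (-(g 1 1 + 1)) * hc
    rw [this]
    exact M.mul_mem (hu _) (M.mul_mem hw (M.mul_mem (hu _) (M.mul_mem hw (hu _))))
  by_cases hg : g 1 0 = 0
  · have h2 : wS * g ∈ M := by
      apply key
      have hd := det_eq g
      rw [hg] at hd
      intro h
      simp [mul_ent, w00, w01, w10, w11, u00, u01, u10, u11] at h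
      simp [h] at hd
      exact absurd hd (by decide)
    have h3 : g = wS * (wS * (wS * (wS * g))) := by
      have : wS * wS * wS * wS = 1 := by decide +kernel
      rw [← mul_assoc, ← mul_assoc, ← mul_assoc, this, one_mul]
    rw [h3]
    exact M.mul_mem hw (M.mul_mem hw (M.mul_mem hw h2))
  · exact key g hg

/-- the representation on matrices -/
def rep (hG : Good p T W) : S5 →* Matrix (Fin 2) (Fin 2) (ZMod p) where
  toFun g := (FF T W g).mat
  map_one' := by
    have : FF T W 1 = ⟨1, 0, 0, 1⟩ := hG.one
    rw [this]; simp [Q.mat, Matrix.one_fin_two]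
  map_mul' := by
    have h := S5_induction
      { carrier := {g : S5 | ∀ h, (FF T W (g * h)).mat = (FF T W g).mat * (FF T W h).mat}
        one_mem' := by
          intro h
          have : FF T W 1 = ⟨1, 0, 0, 1⟩ := hG.one
          rw [this]; simp [Q.mat, ← Matrix.one_fin_two]
        mul_mem' := by
          intro a b ha hb h
          rw [mul_assoc, ha, hb, ha, mul_assoc] }
      (by
        intro h
        have : FF T W wS = W := hG.wF
        rw [FF_w hG, this, Q.mat_mul])
      (by
        intro x h
        have : FF T W (uS x) = T x := hG.uF x
        rw [FF_u hG, this, Q.mat_mul])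
    intro x y
    exact h x y

/-- the representation on linear equivalences -/
noncomputable def repL (hG : Good p T W) : S5 →* (V p ≃ₗ[ZMod p] V p) :=
  (LinearMap.GeneralLinearGroup.generalLinearEquiv (ZMod p) (V p)).toMonoidHom.comp
    (MonoidHom.toHomUnits
      ((Matrix.toLinAlgEquiv' : Matrix (Fin 2) (Fin 2) (ZMod p) ≃ₐ[ZMod p] _).toAlgHom.toMonoidHom.comp
        (rep hG)))

theorem repL_apply (hG : Good p T W) (g : S5) (v : V p) : repL hG g v = (FF T W g).mat *ᵥ v := rfl

end

theorem card_S5 : Nat.card S5 = 120 := by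
  rw [Nat.card_eq_fintype_card]
  decide +kernel

section
variable {p : ℕ} [Fact p.Prime] {T : ZMod 5 → Q p} {W : Q p}

theorem repL_fix (hG : Good p T W) (g : S5) (v : V p) (hv : v ≠ 0) (h : repL hG g v = v) :
    g = 1 := by
  rw [repL_apply] at h
  have h0 : ((FF T W g).mat - 1).det = 0 := by
    rw [← Matrix.exists_mulVec_eq_zero_iff]
    exact ⟨v, hv, by rw [Matrix.sub_mulVec, h, Matrix.one_mulVec, sub_self]⟩
  rw [Matrix.det_fin_two] at h0
  simp [Q.mat] at h0
  obtain ⟨h1, h2, h3, h4⟩ := hG.fix _ _ _ _ (det_eq g) h0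
  apply ext4 <;> simp [*]

theorem repL_inj (hG : Good p T W) : Function.Injective (repL hG) := by
  rw [injective_iff_map_eq_one]
  intro g hg
  refine repL_fix hG g ![1, 0] ?_ (by rw [hg]; rfl)
  intro h
  have := congrFun h 0
  simp at this

theorem repL_neg (hG : Good p T W) (v : V p) : repL hG (-1) v = -v := by
  rw [repL_apply]
  have : FF T W (-1) = ⟨-1, 0, 0, -1⟩ := by
    rw [← hG.neg, FF]
    simp
  rw [this]
  ext i
  fin_cases i <;> simp [Q.mat, Matrix.mulVec, dotProduct]

theorem repL_scal (hG : Good p T W) (g : S5) (z : ZMod p) (h : ∀ v, repL hG g v = z • v) :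
    g = 1 ∨ g = -1 := by
  have h1 := h ![1, 0]
  have h2 := h ![0, 1]
  rw [repL_apply] at h1 h2
  have h10 := congrFun h1 0
  have h11 := congrFun h1 1
  have h20 := congrFun h2 0
  have h21 := congrFun h2 1
  simp [Q.mat, Matrix.mulVec, dotProduct] at h10 h11 h20 h21
  obtain ⟨a1, a2, a3, a4⟩ := hG.scal _ _ _ _ (det_eq g) ⟨h20, h11, h10.trans h21.symm⟩
  rcases a4 with a4 | a4
  · left
    apply ext4 <;> simp [*]
  · right
    apply ext4 <;> simp [*]

/-- the map `(z, g) ↦ z g` -/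
noncomputable def rho (hG : Good p T W) (u : (ZMod p)ˣ) :
    Subgroup.zpowers u × S5 →* (V p ≃ₗ[ZMod p] V p) where
  toFun x := DistribMulAction.toModuleAut (ZMod p) (V p) (x.1 : (ZMod p)ˣ) * repL hG x.2
  map_one' := by
    rw [Prod.snd_one, map_one, mul_one, Prod.fst_one, OneMemClass.coe_one, map_one]
  map_mul' x y := by
    ext1 v
    show ((x.1 : (ZMod p)ˣ) * (y.1 : (ZMod p)ˣ)) • repL hG (x.2 * y.2) v =
      (x.1 : (ZMod p)ˣ) • repL hG x.2 ((y.1 : (ZMod p)ˣ) • repL hG y.2 v)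
    rw [map_mul, mul_smul, LinearEquiv.mul_apply, Units.smul_def (y.1 : (ZMod p)ˣ),
      Units.smul_def (y.1 : (ZMod p)ˣ), map_smul]

theorem rho_apply (hG : Good p T W) (u : (ZMod p)ˣ) (x) (v : V p) :
    rho hG u x v = ((x.1 : (ZMod p)ˣ) : ZMod p) • repL hG x.2 v := rfl

theorem rho_ker (hG : Good p T W) (u : (ZMod p)ˣ) (x) (h : rho hG u x = 1) :
    x = 1 ∨ ((x.1 : (ZMod p)ˣ) = -1 ∧ x.2 = -1) := by
  obtain ⟨z, g⟩ := x
  have h1 : ∀ v, ((z : (ZMod p)ˣ) : ZMod p) • repL hG g v = v := by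
    intro v
    rw [← rho_apply hG u (z, g), h]; rfl
  have h2 : ∀ v, repL hG g v = (((z : (ZMod p)ˣ)⁻¹ : (ZMod p)ˣ) : ZMod p) • v := by
    intro v
    conv_rhs => rw [← h1 v]
    rw [smul_smul, Units.inv_mul, one_smul]
  have e := congrFun (h1 ![1, 0]) 0
  rcases repL_scal hG g _ h2 with rfl | rfl
  · left
    simp at e
    rw [e]; rfl
  · right
    rw [repL_neg] at e
    simp at e
    refine ⟨?_, rfl⟩
    ext
    push_cast
    linear_combination -e

theorem rho_card_range (hG : Good p T W) (u : (ZMod p)ˣ) :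
    Nat.card (rho hG u).range * Nat.card (rho hG u).ker = orderOf u * 120 := by
  have h := Subgroup.card_mul_index (rho hG u).ker
  rw [Subgroup.index_ker, Nat.card_prod, card_S5, Nat.card_zpowers] at h
  rw [← h, mul_comm]

theorem card_of_notMem (hG : Good p T W) (u : (ZMod p)ˣ) (h : (-1 : (ZMod p)ˣ) ∉ Subgroup.zpowers u) :
    Nat.card (rho hG u).range = orderOf u * 120 := by
  rw [← rho_card_range hG u]
  have : (rho hG u).ker = ⊥ := by
    rw [eq_bot_iff]
    intro x hx
    rcases rho_ker hG u x hx with h1 | h1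
    · exact h1
    · exact absurd (h1.1 ▸ x.1.2) h
  rw [this]; simp

theorem card_of_mem (hG : Good p T W) (u : (ZMod p)ˣ) (h : (-1 : (ZMod p)ˣ) ∈ Subgroup.zpowers u) :
    Nat.card (rho hG u).range * 2 = orderOf u * 120 := by
  rw [← rho_card_range hG u]
  have h2 : ((rho hG u).ker : Set (Subgroup.zpowers u × S5)) = {1, (⟨-1, h⟩, -1)} := by
    ext x
    constructor
    · intro hx
      rcases rho_ker hG u x hx with h1 | h1
      · exact Or.inl h1
      · exact Or.inr (Prod.ext (Subtype.ext h1.1) h1.2)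
    · rintro (rfl | rfl)
      · exact one_mem _
      · show rho hG u _ = 1
        ext1 v
        rw [rho_apply, repL_neg]
        simp
  have h3 : Nat.card (rho hG u).ker = 2 := by
    change Nat.card ((rho hG u).ker : Set (Subgroup.zpowers u × S5)) = 2
    rw [h2, Nat.card_coe_set_eq, Set.ncard_pair]
    intro h
    have h4 : (1 : S5) = -1 := congrArg (fun x => x.2) h
    exact absurd h4 (by decide +kernel)
  rw [h3]

theorem mem_range (hG : Good p T W) (u : (ZMod p)ˣ) (g : S5) : repL hG g ∈ (rho hG u).range :=
  ⟨(1, g), by ext1 v; rw [rho_apply]; simp⟩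

theorem exists_normal (hG : Good p T W) (u : (ZMod p)ˣ) :
    ∃ R : Subgroup (rho hG u).range, R.Normal ∧
      Nonempty (R ≃* Matrix.SpecialLinearGroup (Fin 2) (ZMod 5)) := by
  have hle : (repL hG).range ≤ (rho hG u).range := by
    rintro _ ⟨g, rfl⟩
    exact mem_range hG u g
  refine ⟨(repL hG).range.subgroupOf (rho hG u).range, ⟨?_⟩,
    ⟨(Subgroup.subgroupOfEquivOfLe hle).trans (MonoidHom.ofInjective (repL_inj hG)).symm⟩⟩
  rintro ⟨_, _⟩ ⟨k, hk⟩ ⟨_, ⟨x, rfl⟩⟩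
  simp at hk
  subst hk
  refine ⟨x.2 * k * x.2⁻¹, ?_⟩
  show _ = rho hG u x * repL hG k * (rho hG u x)⁻¹
  rw [eq_mul_inv_iff_mul_eq]
  ext1 v
  simp only [LinearEquiv.mul_apply, rho_apply, map_smul]
  simp only [← LinearEquiv.mul_apply, ← map_mul]
  simp

theorem example_of (hG : Good p T W) (u : (ZMod p)ˣ) (c o n : ℕ)
    (hc : Nat.card (rho hG u).range = c) (hco : c ≠ o)
    (ho : ∀ v : V p, v ≠ 0 → Nat.card (MulAction.orbit (rho hG u).range v) = o)
    (hn : n * o = p ^ 2 - 1) (hp : 0 < o) : HasHalfTransitiveExample p c o n := by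
  have he : (![1, 0] : V p) ≠ 0 := by
    intro h
    have := congrFun h 0
    simp at this
  refine ⟨(rho hG u).range, hc, exists_normal hG u, ho, ?_, ?_⟩
  · let O := {s : Set (V p) // ∃ v : V p, v ≠ 0 ∧ s = MulAction.orbit (rho hG u).range v}
    let f : {v : V p // v ≠ 0} → O := fun v => ⟨MulAction.orbit (rho hG u).range v.1, v.1, v.2, rfl⟩
    have hf : ∀ s : O, Nat.card {v // f v = s} = o := by
      rintro ⟨_, v, hv, rfl⟩
      rw [← ho v hv]
      refine Nat.card_congr ⟨fun w => ⟨w.1.1, ?_⟩, fun w => ⟨⟨w.1, ?_⟩, ?_⟩, fun _ => rfl, fun _ => rfl⟩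
      · have := congrArg Subtype.val w.2
        rw [← MulAction.orbit_eq_iff]
        exact this
      · obtain ⟨_, g, rfl⟩ := w
        intro h
        apply hv
        have h' : g • v = 0 := h
        rwa [smul_eq_zero_iff_eq] at h'
      · apply Subtype.ext
        exact MulAction.orbit_eq_iff.2 w.2
    have h1 : Nat.card {v : V p // v ≠ 0} = Nat.card O * o := by
      rw [← Nat.card_congr (Equiv.sigmaFiberEquiv f), Nat.card_sigma]
      rw [Finset.sum_congr rfl (fun s _ => hf s)]
      simp
    have h2 : Nat.card {v : V p // v ≠ 0} = p ^ 2 - 1 := by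
      rw [Nat.card_eq_fintype_card, Fintype.card_subtype_compl]
      simp
    have h3 : Nat.card O * o = n * o := by rw [← h1, h2, hn]
    exact Nat.eq_of_mul_eq_mul_right hp h3
  · intro h
    apply hco
    rw [← hc, ← ho _ he]
    refine Nat.card_congr (Equiv.ofBijective
      (fun g => (⟨g • (![1, 0] : V p), g, rfl⟩ : MulAction.orbit (rho hG u).range (![1, 0] : V p))) ⟨?_, ?_⟩)
    · intro g g' hgg
      have h1 : g • (![1, 0] : V p) = g' • (![1, 0] : V p) := congrArg Subtype.val hgg
      have h2 : (g'⁻¹ * g) • (![1, 0] : V p) = ![1, 0] := by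
        rw [mul_smul, h1, inv_smul_smul]
      have := h (g'⁻¹ * g : (rho hG u).range) (g'⁻¹ * g).2 _ he h2
      exact (inv_mul_eq_one.1 (Subtype.ext this)).symm
    · rintro ⟨_, g, rfl⟩
      exact ⟨g, rfl⟩

theorem orbit_eig (hG : Good p T W) (u : (ZMod p)ˣ) (he : Eig p T W u) (v : V p) (hv : v ≠ 0) :
    Nat.card (MulAction.orbit (rho hG u).range v) = 120 := by
  have h1 : ∃ g, repL hG g v = u • v := by
    by_cases h0 : v 0 = 0
    · obtain ⟨a, b, c, d, hd, h1, h2⟩ := he.2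
      refine ⟨mk a b c d hd, ?_⟩
      rw [repL_apply, FF_mk]
      ext i
      fin_cases i <;> simp [Q.mat, Matrix.mulVec, dotProduct, h0, h1, h2, Units.smul_def]
    · obtain ⟨a, b, c, d, hd, h1, h2⟩ := he.1 (v 1 / v 0)
      field_simp at h1 h2
      refine ⟨mk a b c d hd, ?_⟩
      rw [repL_apply, FF_mk]
      ext i
      fin_cases i <;> simp [Q.mat, Matrix.mulVec, dotProduct, Units.smul_def]
      · linear_combination h1
      · linear_combination h2
  obtain ⟨g, hg⟩ := h1
  have h2 : ∀ k : ℕ, repL hG (g ^ k) v = u ^ k • v := by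
    intro k
    induction k with
    | zero => simp
    | succ k ih =>
      rw [pow_succ, map_mul, LinearEquiv.mul_apply, hg, Units.smul_def, map_smul, ih, pow_succ',
        mul_smul, Units.smul_def u]
  rw [← card_S5]
  symm
  refine Nat.card_congr (Equiv.ofBijective
    (fun g => (⟨repL hG g v, ⟨_, mem_range hG u g⟩, rfl⟩ : MulAction.orbit (rho hG u).range v)) ⟨?_, ?_⟩)
  · intro g g' hgg
    have h1 : repL hG g v = repL hG g' v := congrArg Subtype.val hgg
    refine (inv_mul_eq_one.1 (repL_fix hG (g'⁻¹ * g) v hv ?_)).symm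
    rw [map_mul, LinearEquiv.mul_apply, h1, ← LinearEquiv.mul_apply, ← map_mul]
    simp
  · rintro ⟨_, ⟨_, ⟨⟨z, hz⟩, k⟩, rfl⟩, rfl⟩
    obtain ⟨m, rfl⟩ := (Submonoid.mem_powers_iff _ _).1 ((mem_powers_iff_mem_zpowers).2 hz)
    refine ⟨k * g ^ m, Subtype.ext ?_⟩
    show repL hG (k * g ^ m) v = rho hG u _ v
    rw [map_mul, LinearEquiv.mul_apply, h2, rho_apply, Units.smul_def, map_smul]

theorem orbit_trans (hG : Good p T W) (u : (ZMod p)ˣ) (he : Trans p T W)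
    (hu : ∀ x : (ZMod p)ˣ, x ∈ Subgroup.zpowers u ∨ -x ∈ Subgroup.zpowers u)
    (v : V p) (hv : v ≠ 0) :
    Nat.card (MulAction.orbit (rho hG u).range v) = p ^ 2 - 1 := by
  have hs : ∀ (x : (ZMod p)ˣ) (g : S5),
      ∃ k : (rho hG u).range, ∀ w : V p, k • w = (x : ZMod p) • repL hG g w := by
    intro x g
    rcases hu x with h | h
    · exact ⟨⟨_, (⟨x, h⟩, g), rfl⟩, fun w => rfl⟩
    · refine ⟨⟨_, (⟨-x, h⟩, -1 * g), rfl⟩, fun w => ?_⟩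
      show rho hG u _ w = _
      rw [rho_apply, map_mul, LinearEquiv.mul_apply, repL_neg]
      simp
  have h1 : ∀ w : V p, w ≠ 0 → ∃ k : (rho hG u).range, k • (![1, 0] : V p) = w := by
    intro w hw
    by_cases h0 : w 0 = 0
    · have hw1 : w 1 ≠ 0 := by
        intro h
        apply hw
        ext i
        fin_cases i <;> simp [*]
      obtain ⟨a, b, c, d, hd, h1⟩ := he.2
      have hc : (F T W a b c d).c ≠ 0 := by
        intro h
        have h3 : repL hG (mk a b c d hd) ![1, 0] = 0 := by
          rw [repL_apply, FF_mk]
          ext i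
          fin_cases i <;> simp [Q.mat, Matrix.mulVec, dotProduct, h1, h]
        rw [LinearEquiv.map_eq_zero_iff] at h3
        have := congrFun h3 0
        simp at this
      obtain ⟨k, hk⟩ := hs (Units.mk0 (w 1 / (F T W a b c d).c) (div_ne_zero hw1 hc)) (mk a b c d hd)
      refine ⟨k, ?_⟩
      rw [hk, repL_apply, FF_mk]
      ext i
      fin_cases i <;> simp [Q.mat, Matrix.mulVec, dotProduct, h1, h0, hc]
    · obtain ⟨a, b, c, d, hd, ha, h1⟩ := he.1 (w 1 / w 0)
      obtain ⟨k, hk⟩ := hs (Units.mk0 (w 0 / (F T W a b c d).a) (div_ne_zero h0 ha)) (mk a b c d hd)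
      refine ⟨k, ?_⟩
      rw [hk, repL_apply, FF_mk]
      ext i
      fin_cases i <;> simp [Q.mat, Matrix.mulVec, dotProduct, h1, ha]
      field_simp
  have h2 : MulAction.orbit (rho hG u).range v = {w : V p | w ≠ 0} := by
    ext w
    constructor
    · rintro ⟨g, rfl⟩ h
      apply hv
      have h' : g • v = 0 := h
      rwa [smul_eq_zero_iff_eq] at h'
    · intro hw
      obtain ⟨k, hk⟩ := h1 v hv
      obtain ⟨l, hl⟩ := h1 w hw
      refine ⟨l * k⁻¹, ?_⟩
      show (l * k⁻¹) • v = w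
      rw [← hk, mul_smul, inv_smul_smul, hl]
  rw [h2]
  show Nat.card {v : V p // v ≠ 0} = p ^ 2 - 1
  rw [Nat.card_eq_fintype_card, Fintype.card_subtype_compl]
  simp

end

instance : Fact (Nat.Prime 11) := ⟨by norm_num⟩
instance : Fact (Nat.Prime 19) := ⟨by norm_num⟩
instance : Fact (Nat.Prime 29) := ⟨by norm_num⟩

def z11 : (ZMod 11)ˣ := ⟨3, 4, by decide, by decide⟩
def z19a : (ZMod 19)ˣ := ⟨7, 11, by decide, by decide⟩
def z19b : (ZMod 19)ˣ := ⟨4, 5, by decide, by decide⟩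
def z29a : (ZMod 29)ˣ := ⟨12, 17, by decide, by decide⟩
def z29b : (ZMod 29)ˣ := ⟨2, 15, by decide, by decide⟩

theorem ord11 : orderOf z11 = 5 := by
  rw [orderOf_eq_iff (by norm_num)]; decide +kernel
theorem ord19a : orderOf z19a = 3 := by
  rw [orderOf_eq_iff (by norm_num)]; decide +kernel
theorem ord19b : orderOf z19b = 9 := by
  rw [orderOf_eq_iff (by norm_num)]; decide +kernel
theorem ord29a : orderOf z29a = 4 := by
  rw [orderOf_eq_iff (by norm_num)]; decide +kernel
theorem ord29b : orderOf z29b = 28 := by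
  rw [orderOf_eq_iff (by norm_num)]; decide +kernel

theorem notMem_of_odd {p : ℕ} [Fact p.Prime] (u : (ZMod p)ˣ) (hp : (-1 : (ZMod p)ˣ) ≠ 1)
    (h : Odd (orderOf u)) : (-1 : (ZMod p)ˣ) ∉ Subgroup.zpowers u := by
  rintro ⟨k, hk⟩
  apply hp
  have h1 : (-1 : (ZMod p)ˣ) ^ orderOf u = -1 := h.neg_one_pow
  rw [← h1, ← hk]
  show (u ^ k) ^ orderOf u = 1
  rw [← zpow_natCast, zpow_comm, zpow_natCast, pow_orderOf_eq_one, _root_.one_zpow]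

theorem gen_of {p : ℕ} (u : (ZMod p)ˣ) (N : ℕ)
    (h : ∀ x : (ZMod p)ˣ, ∃ k : Fin N, u ^ (k : ℕ) = x ∨ u ^ (k : ℕ) = -x) (x : (ZMod p)ˣ) :
    x ∈ Subgroup.zpowers u ∨ -x ∈ Subgroup.zpowers u := by
  obtain ⟨k, hk | hk⟩ := h x
  · left; rw [← hk]; exact Subgroup.npow_mem_zpowers u k
  · right; rw [← hk]; exact Subgroup.npow_mem_zpowers u k

theorem ex1 : HasHalfTransitiveExample 11 600 120 1 := by
  refine example_of good11 z11 _ _ _ ?_ (by norm_num) ?_ (by norm_num) (by norm_num)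
  · rw [card_of_notMem _ _ (notMem_of_odd _ (by decide) (by rw [ord11]; decide)), ord11]
  · exact orbit_trans good11 z11 trans11 (gen_of _ 5 (by decide +kernel))

theorem ex2 : HasHalfTransitiveExample 19 360 120 3 := by
  refine example_of good19 z19a _ _ _ ?_ (by norm_num) ?_ (by norm_num) (by norm_num)
  · rw [card_of_notMem _ _ (notMem_of_odd _ (by decide) (by rw [ord19a]; decide)), ord19a]
  · exact orbit_eig good19 z19a eig19

theorem ex3 : HasHalfTransitiveExample 19 1080 360 1 := by
  refine example_of good19 z19b _ _ _ ?_ (by norm_num) ?_ (by norm_num) (by norm_num)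
  · rw [card_of_notMem _ _ (notMem_of_odd _ (by decide) (by rw [ord19b]; decide)), ord19b]
  · exact orbit_trans good19 z19b trans19 (gen_of _ 9 (by decide +kernel))

theorem ex4 : HasHalfTransitiveExample 29 240 120 7 := by
  refine example_of good29 z29a _ _ _ ?_ (by norm_num) ?_ (by norm_num) (by norm_num)
  · have := card_of_mem good29 z29a ⟨2, by decide +kernel⟩
    rw [ord29a] at this
    lia
  · exact orbit_eig good29 z29a eig29

theorem ex5 : HasHalfTransitiveExample 29 1680 840 1 := by
  refine example_of good29 z29b _ _ _ ?_ (by norm_num) ?_ (by norm_num) (by norm_num)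
  · have := card_of_mem good29 z29b ⟨14, by decide +kernel⟩
    rw [ord29b] at this
    lia
  · exact orbit_trans good29 z29b trans29 (gen_of _ 28 (by decide +kernel))

end HT

/-- **Table 1 examples (Liebeck–Praeger–Saxl).** The `½`-transitive, non-semiregular linear
groups `SL₂(5) ⊴ G ≤ GL₂(p)` for `p = 11, 19, 29`, with their orbit structures. -/
theorem halfTransitive_examples_gl2 :
    HasHalfTransitiveExample 11 600 120 1 ∧
    HasHalfTransitiveExample 19 360 120 3 ∧
    HasHalfTransitiveExample 19 1080 360 1 ∧
    HasHalfTransitiveExample 29 240 120 7 ∧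
    HasHalfTransitiveExample 29 1680 840 1 := by
  exact ⟨HT.ex1, HT.ex2, HT.ex3, HT.ex4, HT.ex5⟩
end
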